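/- Let k be a field of characteristic p > 0, let α be a natural number, set q = p^α, and write V_s for the k[x]-module k[x]/(x−1)^s. For every integer r with q < r ≤ (p−1)q there is an isomorphism of k[x]-modules V_{q+1} ⊗ V_r ≅ (V_{q−1} ⊗ V_r) ⊕ V_{r+q} ⊕ V_{r−q}. -/

import Mathlib

open Polynomial TensorProduct

/-- The `k`-linear operator on the `k[x]`-module `k[x]/(h)` given by the action of `x`,
i.e. multiplication by `x`. -/
noncomputable def mulXop (k : Type*) [Field k] (h : k[X]) :
    (k[X] ⧸ Ideal.span {h}) →ₗ[k] (k[X] ⧸ Ideal.span {h}) :=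
  LinearMap.mulLeft k (Ideal.Quotient.mk (Ideal.span {h}) X)

/-- Two `k[x]`-modules, presented as vector spaces equipped with the `k`-linear operator
by which `x` acts, are isomorphic iff there is a `k`-linear equivalence intertwining the
two operators. -/
def OpIso {k V W : Type*} [Field k] [AddCommGroup V] [Module k V]
    [AddCommGroup W] [Module k W] (f : V →ₗ[k] V) (g : W →ₗ[k] W) : Prop :=
  ∃ e : V ≃ₗ[k] W, ∀ v, e (f v) = g (e v)

/-- The direct sum of a family of operators, as an operator on the direct sum
(product) of the underlying spaces. -/
def piOp {k : Type*} [Field k] {ι : Type*} {V : ι → Type*} [∀ i, AddCommGroup (V i)]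
    [∀ i, Module k (V i)] (f : ∀ i, V i →ₗ[k] V i) : (∀ i, V i) →ₗ[k] (∀ i, V i) :=
  LinearMap.pi fun i => (f i).comp (LinearMap.proj i)


lemma OpIso.symm' {k V W : Type*} [Field k] [AddCommGroup V] [Module k V]
    [AddCommGroup W] [Module k W] {f : V →ₗ[k] V} {g : W →ₗ[k] W} (h : OpIso f g) : OpIso g f := by
  obtain ⟨e, he⟩ := h
  refine ⟨e.symm, fun v => ?_⟩
  apply e.injective
  rw [he]; simp

lemma OpIso.trans' {k V W U : Type*} [Field k] [AddCommGroup V] [Module k V]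
    [AddCommGroup W] [Module k W] [AddCommGroup U] [Module k U]
    {f : V →ₗ[k] V} {g : W →ₗ[k] W} {l : U →ₗ[k] U}
    (h : OpIso f g) (h' : OpIso g l) : OpIso f l := by
  obtain ⟨e, he⟩ := h
  obtain ⟨e', he'⟩ := h'
  exact ⟨e.trans e', fun v => by simp [he, he']⟩

lemma finrank_Vs (k : Type*) [Field k] (n : ℕ) :
    Module.finrank k (k[X] ⧸ Ideal.span {((X : k[X]) - 1) ^ n}) = n := by
  rw [finrank_quotient_span_eq_natDegree, natDegree_pow]
  have : ((X : k[X]) - 1).natDegree = 1 := by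
    simpa using natDegree_X_sub_C (1 : k)
  rw [this, mul_one]

lemma finite_Vs (k : Type*) [Field k] (n : ℕ) :
    Module.Finite k (k[X] ⧸ Ideal.span {((X : k[X]) - 1) ^ n}) := by
  have : ((X : k[X]) - 1).Monic := by simpa using monic_X_sub_C (1 : k)
  exact (this.pow n).finite_quotient

lemma cyc_map {k V : Type*} [Field k] [AddCommGroup V] [Module k V] (f : V →ₗ[k] V)
    (n : ℕ) (v : V) (hv : ((f - 1) ^ n) v = 0) :
    ∃ φ : (k[X] ⧸ Ideal.span {((X : k[X]) - 1) ^ n}) →ₗ[k] V,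
      φ 1 = v ∧ ∀ a, φ (mulXop k _ a) = f (φ a) := by
  let g : k[X] →ₗ[k[X]] Module.AEval' f := LinearMap.toSpanSingleton k[X] _ (Module.AEval'.of f v)
  have hg : Ideal.span {((X : k[X]) - 1) ^ n} ≤ LinearMap.ker g := by
    rw [Ideal.span_le, Set.singleton_subset_iff]
    change g _ = 0
    change (((X : k[X]) - 1) ^ n) • (Module.AEval'.of f v) = 0
    change Module.AEval'.of f (aeval f (((X : k[X]) - 1) ^ n) v) = 0
    simp [hv]
  let ψ := Submodule.liftQ _ g hg
  refine ⟨(Module.AEval'.of f).symm.toLinearMap ∘ₗ (ψ.restrictScalars k), ?_, ?_⟩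
  · change (Module.AEval'.of f).symm ((1 : k[X]) • (Module.AEval'.of f v)) = v
    simp
  · intro a
    obtain ⟨a, rfl⟩ := Ideal.Quotient.mk_surjective a
    change (Module.AEval'.of f).symm ((X * a : k[X]) • (Module.AEval'.of f v)) =
      f ((Module.AEval'.of f).symm ((a : k[X]) • (Module.AEval'.of f v)))
    rw [mul_smul]
    exact Module.AEval.of_symm_X_smul _ _

lemma crit {k V : Type*} [Field k] [AddCommGroup V] [Module k V] [Module.Finite k V]
    (f : V →ₗ[k] V) {ι : Type*} [Fintype ι] (l : ι → ℕ) (e : ι → V)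
    (hann : ∀ i, ((f - 1) ^ l i) (e i) = 0) (N : ℕ) (hnil : (f - 1) ^ N = 0)
    (hspan : ∀ v : V, ∃ w ∈ Submodule.span k (Set.range e), ∃ u, v = w + (f - 1) u)
    (hdim : ∑ i, l i = Module.finrank k V) :
    OpIso f (piOp fun i => mulXop k ((X - 1) ^ l i)) := by
  choose φ hφ1 hφ using fun i => cyc_map f (l i) (e i) (hann i)
  have := fun i => finite_Vs k (l i)
  let Φ : (∀ i, k[X] ⧸ Ideal.span {((X : k[X]) - 1) ^ l i}) →ₗ[k] V :=
    ∑ i, (φ i).comp (LinearMap.proj i)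
  have hΦ : ∀ a, Φ a = ∑ i, φ i (a i) := fun a => by simp [Φ]
  have hcomm : ∀ a, Φ (piOp (fun i => mulXop k ((X - 1) ^ l i)) a) = f (Φ a) := by
    intro a
    rw [hΦ, hΦ, map_sum]
    exact Finset.sum_congr rfl fun i _ => hφ i (a i)
  have hst : ∀ v ∈ LinearMap.range Φ, (f - 1) v ∈ LinearMap.range Φ := by
    rintro _ ⟨a, rfl⟩
    refine ⟨piOp (fun i => mulXop k ((X - 1) ^ l i)) a - a, ?_⟩
    rw [map_sub, hcomm]; simp
  have he : Submodule.span k (Set.range e) ≤ LinearMap.range Φ := by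
    classical
    rw [Submodule.span_le]
    rintro _ ⟨i, rfl⟩
    refine ⟨Pi.single i 1, ?_⟩
    rw [hΦ, Finset.sum_eq_single i]
    · simp [hφ1]
    · intro j _ hj; simp [Pi.single_eq_of_ne hj]
    · simp
  have hstn : ∀ n : ℕ, ∀ v ∈ LinearMap.range Φ, ((f - 1) ^ n) v ∈ LinearMap.range Φ := by
    intro n
    induction n with
    | zero => intro v hv; simpa using hv
    | succ n ih => intro v hv; rw [pow_succ]; exact ih _ (hst v hv)
  have key : ∀ n : ℕ, ∀ v : V, ∃ w ∈ LinearMap.range Φ, ∃ u, v = w + ((f - 1) ^ n) u := by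
    intro n
    induction n with
    | zero => intro v; exact ⟨0, zero_mem _, v, by simp⟩
    | succ n ih =>
      intro v
      obtain ⟨w, hw, u, rfl⟩ := ih v
      obtain ⟨w', hw', u', rfl⟩ := hspan u
      refine ⟨w + ((f - 1) ^ n) w', add_mem hw (hstn n _ (he hw')), u', ?_⟩
      rw [map_add, pow_succ, add_assoc]; rfl
  have hsurj : Function.Surjective Φ := by
    intro v
    obtain ⟨w, ⟨a, ha⟩, u, hu⟩ := key N v
    refine ⟨a, ?_⟩
    rw [hu, hnil, ha]; simp
  have hfr : Module.finrank k (∀ i, k[X] ⧸ Ideal.span {((X : k[X]) - 1) ^ l i})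
      = Module.finrank k V := by
    rw [Module.finrank_pi_fintype, ← hdim]
    exact Finset.sum_congr rfl fun i _ => finrank_Vs k (l i)
  have hinj : Function.Injective Φ :=
    (LinearMap.injective_iff_surjective_of_finrank_eq_finrank hfr).2 hsurj
  exact OpIso.symm' ⟨LinearEquiv.ofBijective Φ ⟨hinj, hsurj⟩, hcomm⟩

lemma pi_option {k : Type*} [Field k] {ι : Type*} {V : Option (Option ι) → Type*}
    [∀ i, AddCommGroup (V i)] [∀ i, Module k (V i)] (f : ∀ i, V i →ₗ[k] V i) :
    OpIso (piOp f) (((piOp fun i => f (some (some i))).prodMap (f (some none))).prodMap (f none)) := by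
  refine ⟨(LinearEquiv.piOptionEquivProd k).trans ((LinearEquiv.prodComm k _ _).trans
    (LinearEquiv.prodCongr ((LinearEquiv.piOptionEquivProd k).trans (LinearEquiv.prodComm k _ _))
      (LinearEquiv.refl k _))), fun v => ?_⟩
  rfl

lemma prod_congr3 {k V W U U' : Type*} [Field k] [AddCommGroup V] [Module k V]
    [AddCommGroup W] [Module k W] [AddCommGroup U] [Module k U] [AddCommGroup U'] [Module k U']
    {f : V →ₗ[k] V} {g : W →ₗ[k] W} (h : OpIso f g) (a : U →ₗ[k] U) (b : U' →ₗ[k] U') :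
    OpIso ((f.prodMap a).prodMap b) ((g.prodMap a).prodMap b) := by
  obtain ⟨e, he⟩ := h
  refine ⟨LinearEquiv.prodCongr (LinearEquiv.prodCongr e (LinearEquiv.refl k _))
      (LinearEquiv.refl k _), fun v => ?_⟩
  simp [he]

/-- Multiplication-operator version of the criterion. -/
lemma crit_ring {k R : Type*} [Field k] [CommRing R] [Algebra k R] [Module.Finite k R]
    (T z : R) (a : ℕ) (N : ℕ) (hT : T ^ N = 0) (ha : (T - z) ^ a = 0)
    (hgen : ∀ W : Submodule k R, 1 ∈ W → (∀ w ∈ W, T * w ∈ W) → (∀ w ∈ W, z * w ∈ W) → W = ⊤)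
    {ι : Type*} [Fintype ι] (l : ι → ℕ) (e : ι → R)
    (hann : ∀ i, T ^ l i * e i = 0)
    (hspan : ∀ j < a, ∃ i, ∃ u, z ^ j = e i + T * u)
    (hdim : ∑ i, l i = Module.finrank k R) :
    OpIso (LinearMap.mulLeft k (1 + T)) (piOp fun i => mulXop k ((X - 1) ^ l i)) := by
  have h1 : LinearMap.mulLeft k (1 + T) - 1 = LinearMap.mulLeft k T := by
    ext x; simp [add_mul]
  refine crit _ l e (fun i => ?_) N ?_ ?_ hdim
  · rw [h1, LinearMap.pow_mulLeft]; simpa using hann i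
  · rw [h1, LinearMap.pow_mulLeft, hT]; simp
  · rw [h1]
    let S := Submodule.span k (Set.range e)
    let W : Submodule k R := S ⊔ LinearMap.range (LinearMap.mulLeft k T)
    have hTW : ∀ w, T * w ∈ W := fun w => Submodule.mem_sup_right ⟨w, rfl⟩
    have hzW : ∀ j, z ^ j ∈ W := by
      intro j
      by_cases hj : j < a
      · obtain ⟨i, u, h⟩ := hspan j hj
        rw [h]
        exact add_mem (Submodule.mem_sup_left (Submodule.subset_span ⟨i, rfl⟩)) (hTW u)
      · have h2 : T ∣ (T - z) ^ a - (-z) ^ a := by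
          have := sub_dvd_pow_sub_pow (T - z) (-z) a
          simpa using this
        obtain ⟨c, hc⟩ := h2
        have h3 : z ^ a = T * (- (-1) ^ a * c) := by
          rw [ha, neg_pow] at hc
          have : ((-1 : R) ^ a) * (-1) ^ a = 1 := by rw [← mul_pow]; simp
          linear_combination (-(-1) ^ a) * hc - z ^ a * this
        rw [← Nat.sub_add_cancel (not_lt.1 hj), pow_add, h3, mul_left_comm]
        exact hTW _
    let W' : Submodule k R := Submodule.span k (Set.range fun j : ℕ => z ^ j)
        ⊔ LinearMap.range (LinearMap.mulLeft k T)
    have hW' : W' = ⊤ := by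
      apply hgen
      · exact Submodule.mem_sup_left (Submodule.subset_span ⟨0, by simp⟩)
      · intro w _; exact Submodule.mem_sup_right ⟨w, rfl⟩
      · intro w hw
        obtain ⟨x, hx, _, ⟨y, rfl⟩, rfl⟩ := Submodule.mem_sup.1 hw
        rw [mul_add]
        refine add_mem ?_ (Submodule.mem_sup_right ⟨z * y, by simp [mul_left_comm]⟩)
        apply Submodule.mem_sup_left
        clear hw
        induction hx using Submodule.span_induction with
        | mem x h =>
          obtain ⟨j, rfl⟩ := h
          exact Submodule.subset_span ⟨j + 1, by simp [pow_succ, mul_comm]⟩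
        | zero => simp
        | add x y _ _ h1 h2 => 
          rw [mul_add]
          exact add_mem h1 h2
        | smul c x _ h1 =>
          rw [mul_smul_comm]
          exact Submodule.smul_mem _ _ h1
    have hle : W' ≤ W := by
      refine sup_le ?_ le_sup_right
      rw [Submodule.span_le]
      rintro _ ⟨j, rfl⟩
      exact hzW j
    intro v
    have hv : v ∈ W := hle (hW' ▸ Submodule.mem_top)
    obtain ⟨x, hx, _, ⟨y, rfl⟩, rfl⟩ := Submodule.mem_sup.1 hv
    exact ⟨x, hx, y, rfl⟩

lemma sub_pow_q {k R : Type*} [Field k] [CommRing R] [Algebra k R] (p : ℕ) [Fact p.Prime] [CharP k p]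
    (α : ℕ) (T z : R) : (T - z) ^ p ^ α = T ^ p ^ α - z ^ p ^ α := by
  rcases subsingleton_or_nontrivial R with h | h
  · exact Subsingleton.elim _ _
  · have : CharP R p := charP_of_injective_algebraMap (algebraMap k R).injective p
    exact sub_pow_char_pow ..

lemma geom_q {k R : Type*} [Field k] [CommRing R] [Algebra k R] (p : ℕ) [Fact p.Prime] [CharP k p]
    (α : ℕ) (T z : R) : (T - z) ^ (p ^ α - 1) =
      ∑ x ∈ Finset.range (p ^ α), z ^ x * T ^ (p ^ α - 1 - x) := by
  have key : ((MvPolynomial.X 0 : MvPolynomial (Fin 2) k) - MvPolynomial.X 1) ^ (p ^ α - 1) =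
      ∑ x ∈ Finset.range (p ^ α), (MvPolynomial.X 1) ^ x * (MvPolynomial.X 0) ^ (p ^ α - 1 - x) := by
    have hne : ((MvPolynomial.X 0 : MvPolynomial (Fin 2) k) - MvPolynomial.X 1) ≠ 0 := by
      rw [sub_ne_zero]
      intro h
      have := MvPolynomial.X_injective h
      exact absurd this (by decide)
    apply mul_right_cancel₀ hne
    have hq : p ^ α - 1 + 1 = p ^ α :=
      Nat.sub_add_cancel (Nat.one_le_pow _ _ (Fact.out : p.Prime).pos)
    rw [← pow_succ, hq, sub_pow_q (k := k) p α]
    have := geom_sum₂_mul (MvPolynomial.X 1 : MvPolynomial (Fin 2) k) (MvPolynomial.X 0) (p ^ α)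
    linear_combination this
  have := congrArg (MvPolynomial.aeval ![T, z]) key
  simpa using this

/-- block lengths -/
def lenB (q m s i : ℕ) : ℕ := m * q + if i + 1 < s then q else if i + 1 = s then q - s else 0

lemma sum_lenB (q m s : ℕ) (hs : s < q) :
    ∑ i : Fin (q - 1), lenB q m s i = (q - 1) * (m * q + s) := by
  rw [Fin.sum_univ_eq_sum_range (lenB q m s)]
  have key : ∀ n : ℕ, (n < s → ∑ i ∈ Finset.range n,
      (if i + 1 < s then q else if i + 1 = s then q - s else 0) = n * q) ∧
      (s ≤ n → (∑ i ∈ Finset.range n,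
      (if i + 1 < s then q else if i + 1 = s then q - s else 0)) + s = s * q) := by
    intro n
    induction n with
    | zero => constructor <;> simp +contextual
    | succ n ih =>
      obtain ⟨h1, h2⟩ := ih
      rw [Finset.sum_range_succ]
      refine ⟨fun h => ?_, fun h => ?_⟩
      · rw [h1 (by omega), if_pos h]; ring
      · rcases h.eq_or_lt with h | h
        · rw [h1 (by omega), if_neg (by omega), if_pos h.symm, h, add_assoc,
            Nat.sub_add_cancel (by omega)]; ring
        · rw [if_neg (by omega), if_neg (by omega), add_zero, h2 (by omega)]
  have := (key (q - 1)).2 (by omega)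
  unfold lenB
  rw [Finset.sum_add_distrib, Finset.sum_const, Finset.card_range, smul_eq_mul]
  obtain ⟨t, rfl⟩ : ∃ t, q = t + 1 := ⟨q - 1, by omega⟩
  simp only [Nat.add_sub_cancel] at *
  nlinarith

lemma decB {k R : Type*} [Field k] [CommRing R] [Algebra k R] [Module.Finite k R]
    (p : ℕ) [Fact p.Prime] [CharP k p] (α q m s : ℕ) (hq : q = p ^ α) (hs : s < q)
    (T z : R) (N : ℕ) (hT : T ^ N = 0) (ha : (T - z) ^ (q - 1) = 0) (hz : z ^ (m * q + s) = 0)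
    (hgen : ∀ W : Submodule k R, 1 ∈ W → (∀ w ∈ W, T * w ∈ W) → (∀ w ∈ W, z * w ∈ W) → W = ⊤)
    (hdim : Module.finrank k R = (q - 1) * (m * q + s)) :
    OpIso (LinearMap.mulLeft k (1 + T))
      (piOp fun i : Fin (q - 1) => mulXop k ((X - 1) ^ lenB q m s i)) := by
  have hq1 : q - 1 + 1 = q := by omega
  have hzT : z ^ q = T ^ q := by
    have h : (T - z) ^ q = 0 := by rw [← hq1, pow_succ, ha, zero_mul]
    have h2 := sub_pow_q (k := k) p α T z
    rw [← hq, h] at h2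
    linear_combination h2
  have hzz : ∀ n, m * q + s ≤ n → z ^ n = 0 := fun n hn => pow_eq_zero_of_le hn hz
  have hTm : ∀ n i, T ^ (n * q) * z ^ i = z ^ (n * q + i) := by
    intro n i
    rw [pow_add, mul_comm n q, pow_mul, pow_mul, hzT]
  refine crit_ring T z (q - 1) N hT ha hgen (fun i : Fin (q - 1) => lenB q m s i)
    (fun i => if (i : ℕ) + 1 = s then ∑ x ∈ Finset.range s, z ^ x * T ^ (s - 1 - x) else z ^ (i : ℕ))
    ?_ ?_ ?_
  · rintro ⟨i, hi⟩
    simp only [lenB]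
    by_cases h1 : i + 1 = s
    · rw [if_neg (by omega), if_pos h1, if_pos h1]
      have hg := geom_q (k := k) p α T z
      rw [← hq, ha, ← Finset.sum_range_add_sum_Ico _ hs.le] at hg
      have h2 : T ^ (m * q) * ∑ x ∈ Finset.Ico s q, z ^ x * T ^ (q - 1 - x) = 0 := by
        rw [Finset.mul_sum]
        refine Finset.sum_eq_zero fun x hx => ?_
        rw [← mul_assoc, hTm, hzz _ (by have := (Finset.mem_Ico.1 hx).1; omega), zero_mul]
      have h3 : T ^ (q - s) * ∑ x ∈ Finset.range s, z ^ x * T ^ (s - 1 - x) =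
          ∑ x ∈ Finset.range s, z ^ x * T ^ (q - 1 - x) := by
        rw [Finset.mul_sum]
        refine Finset.sum_congr rfl fun x hx => ?_
        have hx := Finset.mem_range.1 hx
        rw [show q - 1 - x = (q - s) + (s - 1 - x) by omega, pow_add]; ring
      rw [pow_add, mul_assoc, h3]
      linear_combination (-T ^ (m * q)) * hg - h2
    · rw [if_neg h1, if_neg h1]
      by_cases h2 : i + 1 < s
      · rw [if_pos h2, ← Nat.succ_mul, hTm]
        apply hzz
        rw [Nat.succ_mul]; omega
      · rw [if_neg h2, add_zero, hTm]
        exact hzz _ (by omega)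
  · intro j hj
    refine ⟨⟨j, hj⟩, ?_⟩
    by_cases h1 : j + 1 = s
    · simp only [h1, if_true]
      rw [← h1, Finset.sum_range_succ]
      have : T ∣ ∑ x ∈ Finset.range j, z ^ x * T ^ (j + 1 - 1 - x) := by
        refine Finset.dvd_sum fun x hx => ?_
        have hx := Finset.mem_range.1 hx
        exact (dvd_pow_self T (by omega)).mul_left _
      obtain ⟨c, hc⟩ := this
      exact ⟨-c, by rw [hc]; simp⟩
    · exact ⟨0, by simp [h1]⟩
  · rw [hdim, sum_lenB q m s hs]

lemma decA {k R : Type*} [Field k] [CommRing R] [Algebra k R] [Module.Finite k R]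
    (p : ℕ) [Fact p.Prime] [CharP k p] (α q m s : ℕ) (hq : q = p ^ α) (hs : s < q)
    (hm0 : 1 ≤ m) (hm : (m : k) ≠ 0) (hm1 : 1 ≤ s → ((m : k) + 1) ≠ 0)
    (T z : R) (N : ℕ) (hT : T ^ N = 0) (ha : (T - z) ^ (q + 1) = 0) (hz : z ^ (m * q + s) = 0)
    (hgen : ∀ W : Submodule k R, 1 ∈ W → (∀ w ∈ W, T * w ∈ W) → (∀ w ∈ W, z * w ∈ W) → W = ⊤)
    (hdim : Module.finrank k R = (q + 1) * (m * q + s)) :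
    OpIso (LinearMap.mulLeft k (1 + T))
      (((piOp fun i : Fin (q - 1) => mulXop k ((X - 1) ^ lenB q m s i)).prodMap
          (mulXop k ((X - 1) ^ (m * q + s + q)))).prodMap
        (mulXop k ((X - 1) ^ (m * q + s - q)))) := by
  obtain ⟨m, rfl⟩ : ∃ t, m = t + 1 := ⟨m - 1, by omega⟩
  obtain ⟨d, hd⟩ : ∃ d, d = z ^ q - T ^ q := ⟨_, rfl⟩
  have hzd : z * d = T * d := by
    have h2 := sub_pow_q (k := k) p α T z
    rw [← hq] at h2
    rw [pow_succ, h2] at ha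
    rw [hd]; linear_combination ha
  have hznd : ∀ n, z ^ n * d = T ^ n * d := by
    intro n
    induction n with
    | zero => simp
    | succ n ih => rw [pow_succ, mul_assoc, hzd, pow_succ]; linear_combination T * ih
  have hzz : ∀ n, (m + 1) * q + s ≤ n → z ^ n = 0 := fun n hn => pow_eq_zero_of_le hn hz
  have hzq : ∀ n : ℕ, z ^ ((n + 1) * q) = T ^ ((n + 1) * q) + (n + 1 : R) * T ^ (n * q) * d := by
    intro n
    induction n with
    | zero => simp [hd]
    | succ n ih =>
      have h1 := hznd q
      rw [add_mul (n + 1) 1 q, pow_add, ih, one_mul, pow_add]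
      push_cast
      have e1 : T ^ ((n + 1) * q) = T ^ (n * q) * T ^ q := by rw [← pow_add]; ring
      rw [e1]
      linear_combination (n + 1 : R) * T ^ (n * q) * h1 - (T ^ (n * q) * T ^ q) * hd
  have F1 : T ^ ((m + 1) * q + s) * d = 0 := by rw [← hznd, hz, zero_mul]
  have F2 : ∀ i, s ≤ i → T ^ ((m + 1) * q) * z ^ i = - ((m + 1 : R) * T ^ (m * q + i) * d) := by
    intro i hi
    have h1 := hzz ((m + 1) * q + i) (by omega)
    rw [pow_add, hzq] at h1
    rw [pow_add]
    linear_combination h1 - (m + 1 : R) * T ^ (m * q) * hznd i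
  have F3 : ∀ i, T ^ ((m + 1 + 1) * q) * z ^ i =
      - ((m + 1 + 1 : R) * T ^ ((m + 1) * q + i) * d) := by
    intro i
    have h1 := hzz ((m + 1 + 1) * q + i) (by rw [add_mul (m + 1) 1 q]; omega)
    rw [pow_add, hzq] at h1
    rw [pow_add]
    push_cast at h1
    linear_combination h1 - (m + 1 + 1 : R) * T ^ ((m + 1) * q) * hznd i
  have hinv : (m + 1 : R) * algebraMap k R ((m + 1 : k)⁻¹) = 1 := by
    have : (m + 1 : R) = algebraMap k R (m + 1) := by simp
    rw [this, ← map_mul, mul_inv_cancel₀ (by exact_mod_cast hm), map_one]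
  have hinv1 : 1 ≤ s → (m + 1 + 1 : R) * algebraMap k R ((m + 1 + 1 : k)⁻¹) = 1 := by
    intro h
    have : (m + 1 + 1 : R) = algebraMap k R (m + 1 + 1) := by simp
    rw [this, ← map_mul, mul_inv_cancel₀ (by exact_mod_cast hm1 h), map_one]
  let lA : Option (Option (Fin (q - 1))) → ℕ := fun o =>
    o.elim ((m + 1) * q + s - q) fun o => o.elim ((m + 1) * q + s + q) fun i => lenB q (m + 1) s i
  let eA : Option (Option (Fin (q - 1))) → R := fun o =>
    o.elim (d + algebraMap k R ((m + 1 : k)⁻¹) * T ^ (q - s) * z ^ s) fun o => o.elim 1 fun i =>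
      if (i : ℕ) + 1 < s then z ^ ((i : ℕ) + 1) - T ^ ((i : ℕ) + 1) else
      if (i : ℕ) + 1 = s then
        z ^ s - (m + 1 : R) * algebraMap k R ((m + 1 + 1 : k)⁻¹) * T ^ s
      else z ^ ((i : ℕ) + 1) - T ^ ((i : ℕ) + 1 - s) * z ^ s
  refine OpIso.trans' ?_ (pi_option (fun o => mulXop k ((X - 1) ^ lA o)))
  refine crit_ring T z (q + 1) N hT ha hgen lA eA ?_ ?_ ?_
  · rintro (_ | _ | ⟨i, hi⟩)
    · change T ^ ((m + 1) * q + s - q) * (d + algebraMap k R ((m + 1 : k)⁻¹) * T ^ (q - s) * z ^ s) = 0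
      have h := F2 s le_rfl
      have e1 : (m + 1) * q + s - q = m * q + s := by rw [add_mul]; omega
      have e2 : T ^ ((m + 1) * q) = T ^ (m * q + s) * T ^ (q - s) := by
        rw [← pow_add]; congr 1; rw [add_mul]; omega
      rw [e2] at h
      rw [e1]
      linear_combination algebraMap k R ((m + 1 : k)⁻¹) * h - T ^ (m * q + s) * d * hinv
    · change T ^ ((m + 1) * q + s + q) * 1 = 0
      have h := F3 0
      have e2 : T ^ ((m + 1) * q + s + q) = T ^ ((m + 1 + 1) * q) * T ^ s := by
        rw [← pow_add]; congr 1; ring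
      rw [e2]
      rw [pow_add] at F1
      rw [add_zero] at h
      linear_combination T ^ s * h - (m + 1 + 1 : R) * F1
    · change T ^ (lenB q (m + 1) s i) * (if i + 1 < s then z ^ (i + 1) - T ^ (i + 1) else
        if i + 1 = s then
          z ^ s - (m + 1 : R) * algebraMap k R ((m + 1 + 1 : k)⁻¹) * T ^ s
        else z ^ (i + 1) - T ^ (i + 1 - s) * z ^ s) = 0
      unfold lenB
      by_cases h1 : i + 1 < s
      · rw [if_pos h1, if_pos h1]
        have e : (m + 1) * q + q = (m + 1 + 1) * q := by ring
        rw [e]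
        have h2 := F3 (i + 1)
        have h3 := F3 0
        rw [pow_add T _ (i + 1)] at h2
        rw [add_zero] at h3
        linear_combination h2 - T ^ (i + 1) * h3
      · rw [if_neg h1, if_neg h1]
        by_cases h2 : i + 1 = s
        · rw [if_pos h2, if_pos h2]
          have h3 := F2 s le_rfl
          have h4 := F3 0
          have e1 : T ^ ((m + 1 + 1) * q) = T ^ ((m + 1) * q) * T ^ (q - s) * T ^ s := by
            rw [← pow_add, ← pow_add]; congr 1; rw [add_mul (m + 1)]; omega
          have e2 : T ^ ((m + 1) * q) = T ^ (m * q + s) * T ^ (q - s) := by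
            rw [← pow_add]; congr 1; rw [add_mul]; omega
          have hi := hinv1 (by omega)
          rw [pow_add]
          rw [e1, add_zero] at h4
          set c := algebraMap k R ((m + 1 + 1 : k)⁻¹)
          linear_combination T ^ (q - s) * h3 - (m + 1 : R) * c * h4 +
            (m + 1 : R) * T ^ ((m + 1) * q) * d * hi + (m + 1 : R) * d * e2
        · rw [if_neg h2, if_neg h2, add_zero]
          have h3 := F2 s le_rfl
          have h4 := F2 (i + 1) (by omega)
          have e2 : T ^ (m * q + (i + 1)) = T ^ (m * q + s) * T ^ (i + 1 - s) := by
            rw [← pow_add]; congr 1; omega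
          rw [e2] at h4
          linear_combination h4 - T ^ (i + 1 - s) * h3
  · have hTd : ∀ n, 0 < n → ∃ c, T ^ n = T * c := fun n hn => dvd_pow_self T hn.ne'
    intro j hj
    rcases Nat.eq_zero_or_pos j with rfl | hj0
    · exact ⟨some none, 0, by simp [eA]⟩
    · rcases (Nat.lt_succ_iff.1 hj).eq_or_lt with rfl | hjq
      · obtain ⟨c, hc⟩ := hTd (j - s) (by omega)
        obtain ⟨c', hc'⟩ := hTd j (by omega)
        refine ⟨none, c' - algebraMap k R ((m + 1 : k)⁻¹) * c * z ^ s, ?_⟩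
        change _ = (d + algebraMap k R ((m + 1 : k)⁻¹) * T ^ (j - s) * z ^ s) + _
        rw [hd, hc, hc']; ring
      · refine ⟨some (some ⟨j - 1, by omega⟩), ?_⟩
        change ∃ u, _ = (if (j - 1) + 1 < s then z ^ ((j - 1) + 1) - T ^ ((j - 1) + 1) else
          if (j - 1) + 1 = s then
            z ^ s - (m + 1 : R) * algebraMap k R ((m + 1 + 1 : k)⁻¹) * T ^ s
          else z ^ ((j - 1) + 1) - T ^ ((j - 1) + 1 - s) * z ^ s) + T * u
        rw [Nat.sub_add_cancel hj0]
        by_cases h1 : j < s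
        · rw [if_pos h1]
          obtain ⟨c, hc⟩ := hTd j (by omega)
          exact ⟨c, by rw [hc]; ring⟩
        · rw [if_neg h1]
          by_cases h2 : j = s
          · rw [if_pos h2]
            subst h2
            obtain ⟨c, hc⟩ := hTd j (by omega)
            exact ⟨(m + 1 : R) * algebraMap k R ((m + 1 + 1 : k)⁻¹) * c, by rw [hc]; ring⟩
          · rw [if_neg h2]
            obtain ⟨c, hc⟩ := hTd (j - s) (by omega)
            exact ⟨c * z ^ s, by rw [hc]; ring⟩
  · rw [Fintype.sum_option, Fintype.sum_option]
    change ((m + 1) * q + s - q) + (((m + 1) * q + s + q) + ∑ i : Fin (q - 1), lenB q (m + 1) s i) = _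
    rw [sum_lenB q (m + 1) s hs, hdim]
    have e1 : (m + 1) * q + s - q = m * q + s := by rw [add_mul]; omega
    rw [e1]
    obtain ⟨t, rfl⟩ : ∃ t, q = t + 1 := ⟨q - 1, by omega⟩
    simp only [Nat.add_sub_cancel]
    ring

lemma nil_aux {R : Type*} [CommRing R] (x y : R) (a b : ℕ) (hx : (x - 1) ^ a = 0)
    (hy : (y - 1) ^ b = 0) : (x * y - 1) ^ (a + b) = 0 := by
  have : x * y - 1 = (x - 1) * y + (y - 1) := by ring
  rw [this]
  apply (Commute.all _ _).add_pow_eq_zero_of_add_le_succ_of_pow_eq_zero (m := a) (n := b)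
  · rw [mul_pow, hx, zero_mul]
  · exact hy
  · omega

universe u

lemma tensor_facts_aux {k : Type u} [Field k] (p : ℕ) [Fact p.Prime] [CharP k p] (a b : ℕ)
    (A B : Type u) [CommRing A] [Algebra k A] [Module.Finite k A]
    [CommRing B] [Algebra k B] [Module.Finite k B] (xa : A) (xb : B)
    (hxa : (xa - 1) ^ a = 0) (hxb : (xb - 1) ^ b = 0)
    (hsa : ∀ f : A, ∃ g : k[X], aeval xa g = f) (hsb : ∀ f : B, ∃ g : k[X], aeval xb g = f)
    (hda : Module.finrank k A = a) (hdb : Module.finrank k B = b) :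
    ∃ (R : Type u) (_ : CommRing R) (_ : Algebra k R) (_ : Module.Finite k R) (T z : R) (N : ℕ),
      T ^ N = 0 ∧ (T - z) ^ a = 0 ∧ z ^ b = 0 ∧
      (∀ W : Submodule k R, 1 ∈ W → (∀ w ∈ W, T * w ∈ W) → (∀ w ∈ W, z * w ∈ W) → W = ⊤) ∧
      Module.finrank k R = a * b ∧
      OpIso (TensorProduct.map (LinearMap.mulLeft k xa) (LinearMap.mulLeft k xb))
        (LinearMap.mulLeft k (1 + T)) := by
  let x1 : A ⊗[k] B := xa ⊗ₜ 1
  let x2 : A ⊗[k] B := 1 ⊗ₜ xb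
  have h1 : (x1 - 1) ^ a = 0 := by
    have : x1 - 1 = (xa - 1) ⊗ₜ (1 : B) := by
      rw [TensorProduct.sub_tmul]; rfl
    rw [this, Algebra.TensorProduct.tmul_pow, hxa, TensorProduct.zero_tmul]
  have h2 : (x2 - 1) ^ b = 0 := by
    have : x2 - 1 = (1 : A) ⊗ₜ (xb - 1) := by
      rw [TensorProduct.tmul_sub]; rfl
    rw [this, Algebra.TensorProduct.tmul_pow, hxb, TensorProduct.tmul_zero]
  have hn : (x1 * x2 - 1) ^ (a + b) = 0 := nil_aux x1 x2 a b h1 h2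
  refine ⟨A ⊗[k] B, inferInstance, inferInstance, inferInstance, x1 * x2 - 1, x2 - 1, a + b,
    hn, ?_, h2, ?_, ?_, ?_⟩
  · have : x1 * x2 - 1 - (x2 - 1) = (x1 - 1) * x2 := by ring
    rw [this, mul_pow, h1, zero_mul]
  · intro W hW1 hWT hWz
    have hx2 : ∀ w ∈ W, x2 * w ∈ W := fun w hw => by
      have := add_mem (hWz w hw) hw
      convert this using 1; ring
    have hx2n : ∀ n : ℕ, ∀ w ∈ W, x2 ^ n * w ∈ W := by
      intro n
      induction n with
      | zero => intro w hw; simpa using hw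
      | succ n ih => intro w hw; rw [pow_succ, mul_assoc]; exact ih _ (hx2 w hw)
    have hone : x2 ^ (p ^ b) = 1 := by
      have := sub_pow_q (k := k) p b x2 1
      rw [pow_eq_zero_of_le (Nat.lt_pow_self (Fact.out : p.Prime).one_lt).le h2, one_pow] at this
      exact (sub_eq_zero.1 this.symm)
    have hpos : p ^ b - 1 + 1 = p ^ b :=
      Nat.sub_add_cancel (Nat.one_le_pow _ _ (Fact.out : p.Prime).pos)
    have hx1 : ∀ w ∈ W, x1 * w ∈ W := fun w hw => by
      have hw' := hx2n (p ^ b - 1) w hw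
      have h3 := add_mem (hWT _ hw') hw'
      have h4 : x2 * x2 ^ (p ^ b - 1) = 1 := by rw [← pow_succ', hpos, hone]
      convert h3 using 1
      linear_combination (-x1 * w) * h4
    have hpoly : ∀ x : A ⊗[k] B, (∀ w ∈ W, x * w ∈ W) → ∀ g : k[X], ∀ w ∈ W, aeval x g * w ∈ W := by
      intro x hx g
      induction g using Polynomial.induction_on' with
      | add g h ih1 ih2 =>
        intro w hw; rw [map_add, add_mul]; exact add_mem (ih1 w hw) (ih2 w hw)
      | monomial n c =>
        intro w hw
        rw [aeval_monomial, mul_assoc, ← Algebra.smul_def]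
        apply Submodule.smul_mem
        induction n with
        | zero => simpa using hw
        | succ n ih => rw [pow_succ', mul_assoc]; exact hx _ ih
    rw [eq_top_iff]
    rintro v -
    induction v using TensorProduct.induction_on with
    | zero => exact zero_mem _
    | add x y hx hy => exact add_mem hx hy
    | tmul f g =>
      obtain ⟨f, rfl⟩ := hsa f
      obtain ⟨g, rfl⟩ := hsb g
      have h3 := hpoly x1 hx1 f _ (hpoly x2 hx2 g 1 hW1)
      have e1 : aeval x1 f = (aeval xa f) ⊗ₜ[k] (1 : B) :=
        aeval_algHom_apply (Algebra.TensorProduct.includeLeft : A →ₐ[k] A ⊗[k] B) xa f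
      have e2 : aeval x2 g = (1 : A) ⊗ₜ[k] (aeval xb g) :=
        aeval_algHom_apply (Algebra.TensorProduct.includeRight : B →ₐ[k] A ⊗[k] B) xb g
      rw [e1, e2, mul_one, Algebra.TensorProduct.tmul_mul_tmul, mul_one, one_mul] at h3
      exact h3
  · rw [Module.finrank_tensorProduct, hda, hdb]
  · refine ⟨LinearEquiv.refl k _, fun v => ?_⟩
    have : x1 * x2 = xa ⊗ₜ[k] xb := by
      simp [x1, x2]
    rw [add_sub_cancel, this]
    change TensorProduct.map (LinearMap.mulLeft k xa) (LinearMap.mulLeft k xb) v = xa ⊗ₜ[k] xb * v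
    induction v using TensorProduct.induction_on with
    | zero => simp
    | add x y hx hy => rw [map_add, mul_add, hx, hy]
    | tmul f g => simp

lemma Vs_pow (k : Type*) [Field k] (n : ℕ) :
    (Ideal.Quotient.mk (Ideal.span {((X : k[X]) - 1) ^ n}) X - 1) ^ n = 0 := by
  have : Ideal.Quotient.mk (Ideal.span {((X : k[X]) - 1) ^ n}) ((X - 1) ^ n) = 0 :=
    Ideal.Quotient.eq_zero_iff_mem.2 (Ideal.subset_span rfl)
  rw [map_pow, map_sub, map_one] at this
  exact this

lemma Vs_surj (k : Type*) [Field k] (h : k[X]) (f : k[X] ⧸ Ideal.span {h}) :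
    ∃ g : k[X], aeval (Ideal.Quotient.mk (Ideal.span {h}) X) g = f := by
  obtain ⟨g, rfl⟩ := Ideal.Quotient.mk_surjective f
  refine ⟨g, ?_⟩
  have := aeval_algHom_apply (Ideal.Quotient.mkₐ k (Ideal.span {h})) X g
  rw [aeval_X_left_apply] at this
  exact this

lemma tensor_facts {k : Type u} [Field k] (p : ℕ) [Fact p.Prime] [CharP k p] (a b : ℕ) :
    ∃ (R : Type u) (_ : CommRing R) (_ : Algebra k R) (_ : Module.Finite k R) (T z : R) (N : ℕ),
      T ^ N = 0 ∧ (T - z) ^ a = 0 ∧ z ^ b = 0 ∧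
      (∀ W : Submodule k R, 1 ∈ W → (∀ w ∈ W, T * w ∈ W) → (∀ w ∈ W, z * w ∈ W) → W = ⊤) ∧
      Module.finrank k R = a * b ∧
      OpIso (TensorProduct.map (mulXop k ((X - 1) ^ a)) (mulXop k ((X - 1) ^ b)))
        (LinearMap.mulLeft k (1 + T)) := by
  have := finite_Vs k a
  have := finite_Vs k b
  exact tensor_facts_aux p a b (k[X] ⧸ Ideal.span {((X : k[X]) - 1) ^ a})
    (k[X] ⧸ Ideal.span {((X : k[X]) - 1) ^ b}) _ _ (Vs_pow k a) (Vs_pow k b)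
    (Vs_surj k _) (Vs_surj k _) (finrank_Vs k a) (finrank_Vs k b)

theorem stmt11 {k : Type*} [Field k] (p : ℕ) (hp : 0 < p) [CharP k p] (α : ℕ)
    (q : ℕ) (hq : q = p ^ α) (r : ℕ) (hr1 : q < r) (hrq : r ≤ (p - 1) * q) :
    OpIso
      (TensorProduct.map (mulXop k ((X - 1) ^ (q + 1))) (mulXop k ((X - 1) ^ r)))
      (((TensorProduct.map (mulXop k ((X - 1) ^ (q - 1))) (mulXop k ((X - 1) ^ r))).prodMap
          (mulXop k ((X - 1) ^ (r + q)))).prodMap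
        (mulXop k ((X - 1) ^ (r - q)))) := by
  have hprime : p.Prime := (CharP.char_is_prime_or_zero k p).resolve_right hp.ne'
  have : Fact p.Prime := ⟨hprime⟩
  have hq0 : 0 < q := by rw [hq]; exact Nat.pow_pos hp
  obtain ⟨m, s, hs, rfl⟩ : ∃ m s, s < q ∧ r = m * q + s :=
    ⟨r / q, r % q, Nat.mod_lt _ hq0, (Nat.div_add_mod' r q).symm⟩
  have hm0 : 1 ≤ m := by
    by_contra h
    have : m = 0 := by omega
    subst this; omega
  have hmp : m ≤ p - 1 := by
    by_contra h
    have : (p - 1 + 1) * q ≤ m * q := Nat.mul_le_mul_right q (by omega)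
    rw [add_mul] at this
    omega
  have hmp1 : 1 ≤ s → m + 1 ≤ p - 1 := by
    intro h1
    by_contra h
    have : (p - 1) * q ≤ m * q := Nat.mul_le_mul_right q (by omega)
    omega
  have hm : (m : k) ≠ 0 := by
    rw [Ne, CharP.cast_eq_zero_iff k p]
    intro h
    have := Nat.le_of_dvd (by omega) h
    omega
  have hm1 : 1 ≤ s → (m : k) + 1 ≠ 0 := by
    intro h1
    have h2 := hmp1 h1
    have : ((m + 1 : ℕ) : k) ≠ 0 := by
      rw [Ne, CharP.cast_eq_zero_iff k p]
      intro h
      have := Nat.le_of_dvd (by omega) h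
      omega
    exact_mod_cast this
  obtain ⟨R, _, _, _, T, z, N, hT, ha, hz, hgen, hdim, hiso⟩ :=
    tensor_facts (k := k) p (q + 1) (m * q + s)
  obtain ⟨R', _, _, _, T', z', N', hT', ha', hz', hgen', hdim', hiso'⟩ :=
    tensor_facts (k := k) p (q - 1) (m * q + s)
  have hA := hiso.trans' (decA p α q m s hq hs hm0 hm hm1 T z N hT ha hz hgen hdim)
  have hB := hiso'.trans' (decB p α q m s hq hs T' z' N' hT' ha' hz' hgen' hdim')
  exact hA.trans' (prod_congr3 hB.symm' _ _)
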